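/- Let Γ ∈ ℝ^{4×4} be the matrix with rows (0,0,1,0), (0,1,0,0), (0,0,1,0), (1,1,−1,0), regarded as a linear map γ : (ℝ²)² → (ℝ²)² on pairs (y_1, y_2) with y_i ∈ ℝ² (q = 2, Y = ℝ²). Then γ is a deadbeat interconnection: γ maps Y_0 = {(y, y) : y ∈ ℝ²} into itself and γ²((ℝ²)²) ⊆ Y_0; moreover, there exist no matrices G, Q ∈ ℝ^{2×2} such that G ⊗ Q = Γ (Kronecker product). -/

import Mathlib

open Matrix Kronecker

/-- The matrix `Γ` with rows `(0,0,1,0), (0,1,0,0), (0,0,1,0), (1,1,-1,0)`,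
indexed by `Fin 2 × Fin 2` (block index first), so that `𝐲 = (y₁, y₂)` with
`yᵢ ∈ ℝ²` is vectorized as `(y₁₁, y₁₂, y₂₁, y₂₂)`. -/
def Γmat : Matrix (Fin 2 × Fin 2) (Fin 2 × Fin 2) ℝ :=
  Matrix.of fun p q =>
    match p, q with
    | (0, 0), (1, 0) => 1
    | (0, 1), (0, 1) => 1
    | (1, 0), (1, 0) => 1
    | (1, 1), (0, 0) => 1
    | (1, 1), (0, 1) => 1
    | (1, 1), (1, 0) => -1
    | _, _ => 0

/-- Membership in `Y₀ = {(y, y) : y ∈ ℝ²}`. -/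
def InY0 (y : Fin 2 × Fin 2 → ℝ) : Prop :=
  ∀ i i' j, y (i, j) = y (i', j)

theorem Γmat_mulVec_apply (y : Fin 2 × Fin 2 → ℝ) :
    (Γmat *ᵥ y) (0, 0) = y (1, 0) ∧ (Γmat *ᵥ y) (0, 1) = y (0, 1) ∧
    (Γmat *ᵥ y) (1, 0) = y (1, 0) ∧
    (Γmat *ᵥ y) (1, 1) = y (0, 0) + y (0, 1) - y (1, 0) := by
  refine ⟨?_, ?_, ?_, ?_⟩ <;>
    simp [Matrix.mulVec, dotProduct, Fintype.sum_prod_type, Fin.sum_univ_two, Γmat]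
  ring

theorem InY0_of (y : Fin 2 × Fin 2 → ℝ) (h0 : y (0, 0) = y (1, 0))
    (h1 : y (0, 1) = y (1, 1)) : InY0 y := by
  intro i i' j
  fin_cases i <;> fin_cases i' <;> fin_cases j <;> simp [h0, h1]

/-- `Γ` is a deadbeat interconnection on `(ℝ²)²`: it maps `Y₀` into `Y₀` and
`γ²((ℝ²)²) ⊆ Y₀`; moreover it is not a Kronecker product `G ⊗ Q` of `2 × 2`
matrices. -/
theorem Gamma_deadbeat_not_kronecker :
    (∀ y : Fin 2 × Fin 2 → ℝ, InY0 y → InY0 (Γmat *ᵥ y)) ∧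
    (∀ y : Fin 2 × Fin 2 → ℝ, InY0 ((fun w => Γmat *ᵥ w)^[2] y)) ∧
    ¬∃ (G Q : Matrix (Fin 2) (Fin 2) ℝ), G ⊗ₖ Q = Γmat := by
  refine ⟨fun y hy => ?_, fun y => ?_, ?_⟩
  · obtain ⟨a, b, c, d⟩ := Γmat_mulVec_apply y
    have h0 := hy 0 1 0
    apply InY0_of
    · rw [a, c]
    · rw [b, d]; linarith
  · obtain ⟨a, b, c, d⟩ := Γmat_mulVec_apply y
    obtain ⟨a', b', c', d'⟩ := Γmat_mulVec_apply (Γmat *ᵥ y)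
    change InY0 (Γmat *ᵥ (Γmat *ᵥ y))
    apply InY0_of
    · rw [a', c']
    · rw [b', d']; linarith
  · rintro ⟨G, Q, h⟩
    have h1 := congrFun (congrFun h (0, 1)) (0, 1)
    have h2 := congrFun (congrFun h (0, 0)) (0, 0)
    have h3 := congrFun (congrFun h (0, 0)) (1, 0)
    simp only [Matrix.kroneckerMap_apply, Γmat, Matrix.of_apply] at h1 h2 h3
    rcases mul_eq_zero.mp h2 with h | h
    · rw [h] at h1; simp at h1
    · rw [h] at h3; simp at h3
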